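/- arXiv:1105.3643 — 3 statements merged into one kernel-verified Lean document; each statement's English description precedes it below -/
import Mathlib

section
/- For every integer k with 1 ≤ k ≤ 8, the Segre product of 6 copies of ℙ¹ is k-identifiable; concretely: there exists a nonzero polynomial P on the parameter space ((ℂ²)^6)^{k+1} such that for every parameter v = (v_{i,j}) with P(v) ≠ 0, every decomposition of length k+1 of the tensor T(v) = Σ_{i=0}^{k} v_{i,0} ⊗ ⋯ ⊗ v_{i,5} ∈ ⨂^6 ℂ² equals the multiset { v_{i,0} ⊗ ⋯ ⊗ v_{i,5} : i = 0,…,k }. (The bound k ≤ 8 is the maximal value ⌊2^6/7⌋ − 1 = 8 for which identifiability is not excluded by the dimension count.) -/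
open scoped TensorProduct

/-- The `m`-fold tensor product of `ℂ²`, the affine cone over the Segre embedding
of `(ℙ¹)^m`. -/
abbrev BinTensor (m : ℕ) := ⨂[ℂ] _ : Fin m, (Fin 2 → ℂ)

/-- A tensor is decomposable if it is a pure tensor `w 0 ⊗ ⋯ ⊗ w (m-1)`. -/
def Decomposable {m : ℕ} (t : BinTensor m) : Prop :=
  ∃ w : Fin m → Fin 2 → ℂ, t = ⨂ₜ[ℂ] j, w j

/-- A decomposition of length `n` of a tensor `T` is a multiset of `n` nonzero
decomposable tensors whose sum is `T`. -/
def IsDecomposition {m : ℕ} (n : ℕ) (T : BinTensor m) (D : Multiset (BinTensor m)) : Prop :=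
  Multiset.card D = n ∧ (∀ t ∈ D, t ≠ 0 ∧ Decomposable t) ∧ D.sum = T

section GeneralAlgebra

open MvPolynomial

variable {τ ι κ : Type}

/-- More polynomials than variables are algebraically dependent. -/
lemma exists_aeval_eq_zero_of_card_lt [Fintype τ] [Fintype ι]
    (f : ι → MvPolynomial τ ℂ) (h : Fintype.card τ < Fintype.card ι) :
    ∃ F : MvPolynomial ι ℂ, F ≠ 0 ∧ aeval f F = 0 := by
  by_contra! hF
  have hi : AlgebraicIndependent ℂ f :=
    (injective_iff_map_eq_zero _).2 fun F h0 => by_contra fun hne => hF F hne h0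
  have := hi.cardinalMk_le_trdeg
  rw [MvPolynomial.trdeg_of_isDomain] at this
  simp only [Cardinal.mk_fintype, Cardinal.lift_natCast, Nat.cast_le] at this
  omega

/-- A nonzero polynomial divides a nonzero polynomial expression in any algebraically independent
family with as many members as there are variables. -/
lemma exists_dvd_aeval [Fintype τ] (t : τ → MvPolynomial τ ℂ) (ht : AlgebraicIndependent ℂ t)
    {q : MvPolynomial τ ℂ} (hq : q ≠ 0) :
    ∃ F : MvPolynomial τ ℂ, aeval t F ≠ 0 ∧ q ∣ aeval t F := by
  have hb : IsTranscendenceBasis ℂ t :=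
    ht.isTranscendenceBasis_of_trdeg_le_of_finite (by simp [MvPolynomial.trdeg_of_isDomain])
  have ha := hb.isAlgebraic
  obtain ⟨⟨r, hr⟩, hr0, hdvd⟩ :=
    (ha.isAlgebraic q).exists_nonzero_dvd (mem_nonZeroDivisors_of_ne_zero hq)
  rw [Algebra.adjoin_range_eq_range_aeval] at hr
  obtain ⟨F, rfl⟩ := hr
  exact ⟨F, fun h => hr0 (Subtype.ext h), hdvd⟩

lemma pderiv_aeval [Fintype ι] (f : ι → MvPolynomial τ ℂ) (F : MvPolynomial ι ℂ) (a : τ) :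
    pderiv a (aeval f F) = ∑ i, aeval f (pderiv i F) * pderiv a (f i) := by
  classical
  induction F using MvPolynomial.induction_on with
  | C c =>
    rw [aeval_C]
    simp
  | add p q hp hq => simp only [map_add, hp, hq, add_mul, Finset.sum_add_distrib]
  | mul_X p i hp =>
    simp only [map_mul, aeval_X, pderiv_mul, hp, map_add, add_mul, Finset.sum_add_distrib,
      pderiv_X]
    congr 1
    · rw [Finset.sum_mul]
      exact Finset.sum_congr rfl fun _ _ => by ring
    · rw [Finset.sum_eq_single i]
      · simp
      · intro j _ hj
        simp [Pi.single_eq_of_ne hj.symm]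
      · simp

lemma totalDegree_pderiv_lt {F : MvPolynomial ι ℂ} {i : ι} (h : pderiv i F ≠ 0) :
    (pderiv i F).totalDegree < F.totalDegree := by
  classical
  obtain ⟨m, hm, hmd⟩ := Finset.exists_mem_eq_sup (pderiv i F).support
    (support_nonempty.2 h) (fun s => s.sum fun _ e => e)
  have hm' : (m + Finsupp.single i 1) ∈ F.support := by
    rw [mem_support_iff, coeff_pderiv] at hm
    rw [mem_support_iff]
    exact left_ne_zero_of_mul hm
  have h1 := le_totalDegree hm'
  rw [Finsupp.sum_add_index' (fun _ => rfl) (fun _ _ _ => rfl),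
    Finsupp.sum_single_index rfl] at h1
  have h2 : (pderiv i F).totalDegree = m.sum fun _ e => e := hmd
  omega

lemma eq_C_of_pderiv_eq_zero {F : MvPolynomial ι ℂ} (h : ∀ i, pderiv i F = 0) :
    F = C (coeff 0 F) := by
  classical
  ext m
  rw [coeff_C]
  split_ifs with h0
  · rw [h0]
  · obtain ⟨i, hi⟩ : ∃ i, m i ≠ 0 := by
      by_contra! h1
      exact h0 (Finsupp.ext h1).symm
    have h2 := congrArg (coeff (m - Finsupp.single i 1)) (h i)
    rw [coeff_pderiv, coeff_zero, tsub_add_cancel_of_le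
      (Finsupp.single_le_iff.2 (Nat.one_le_iff_ne_zero.2 hi))] at h2
    exact (mul_eq_zero.1 h2).resolve_right (Nat.cast_add_one_ne_zero _)

/-- A nontrivial kernel contains a polynomial whose gradient is not in the kernel. -/
lemma exists_pderiv_ne_zero {A : Type} [CommRing A] [Nontrivial A] [Algebra ℂ A]
    (φ : MvPolynomial ι ℂ →ₐ[ℂ] A) (h : ∃ F, F ≠ 0 ∧ φ F = 0) :
    ∃ G, φ G = 0 ∧ ∃ i, φ (pderiv i G) ≠ 0 := by
  classical
  by_contra! H
  obtain ⟨F, hF0, hF⟩ := h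
  induction hd : F.totalDegree using Nat.strong_induction_on generalizing F with
  | _ d ih =>
    by_cases hp : ∀ i, pderiv i F = 0
    · rw [eq_C_of_pderiv_eq_zero hp] at hF hF0
      have h1 : φ (C (coeff 0 F)) = algebraMap ℂ A (coeff 0 F) := φ.commutes _
      rw [h1] at hF
      exact hF0 (by rw [(FaithfulSMul.algebraMap_injective ℂ A) (hF.trans (map_zero _).symm), C_0])
    · push Not at hp
      obtain ⟨i, hi⟩ := hp
      exact ih _ (hd ▸ totalDegree_pderiv_lt hi) _ hi (H F hF i) rfl

/-- The Jacobian criterion for algebraic independence. -/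
lemma algebraicIndependent_of_det_ne_zero [Fintype τ] [DecidableEq τ] (t : τ → MvPolynomial τ ℂ)
    (h : (Matrix.of fun b a => pderiv a (t b)).det ≠ 0) : AlgebraicIndependent ℂ t := by
  refine (injective_iff_map_eq_zero _).2 fun F hF => by_contra fun hne => ?_
  obtain ⟨G, hG, i, hi⟩ := exists_pderiv_ne_zero (aeval t) ⟨F, hne, hF⟩
  refine hi (congrFun (Matrix.eq_zero_of_vecMul_eq_zero h
    (v := fun b => aeval t (pderiv b G)) ?_) i)
  ext1 a
  have := pderiv_aeval t G a
  rw [hG, map_zero] at this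
  simpa [Matrix.vecMul, dotProduct] using this.symm

lemma exists_dual_family [Fintype ι] [DecidableEq κ] (f : κ → ι → ℂ)
    (h : LinearIndependent ℂ f) :
    ∃ L : κ → ι → ℂ, ∀ a b, ∑ i, L a i * f b i = if a = b then 1 else 0 := by
  classical
  obtain ⟨g, hg⟩ := LinearMap.exists_leftInverse_of_injective
    (Finsupp.linearCombination ℂ f) (LinearMap.ker_eq_bot.2 h)
  refine ⟨fun a i => g (Pi.single i 1) a, fun a b => ?_⟩
  have h1 := congrArg (fun u => (u : κ →₀ ℂ) a)
    (LinearMap.congr_fun hg (Finsupp.single b 1))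
  simp only [LinearMap.comp_apply, Finsupp.linearCombination_single, one_smul, LinearMap.id_apply,
    Finsupp.single_apply] at h1
  rw [LinearMap.pi_apply_eq_sum_univ g (f b)] at h1
  simp only [Finsupp.coe_finsetSum, Finset.sum_apply, Finsupp.smul_apply, smul_eq_mul] at h1
  rw [show (if a = b then (1 : ℂ) else 0) = if b = a then 1 else 0 by simp only [eq_comm], ← h1]
  exact Finset.sum_congr rfl fun i _ => by
    simp only [show (Pi.single i 1 : ι → ℂ) = fun j => if i = j then 1 else 0 from
      funext fun j => by simp [Pi.single_apply, eq_comm], mul_comm]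

/-- Linear independence is a Zariski open condition. -/
lemma exists_linearIndependent_of_eval [Fintype ι] [Fintype κ] (f : κ → ι → MvPolynomial τ ℂ)
    (y₀ : τ → ℂ) (h : LinearIndependent ℂ fun k i => eval y₀ (f k i)) :
    ∃ q : MvPolynomial τ ℂ, eval y₀ q ≠ 0 ∧
      ∀ y, eval y q ≠ 0 → LinearIndependent ℂ fun k i => eval y (f k i) := by
  classical
  obtain ⟨L, hL⟩ := exists_dual_family _ h
  have key : ∀ y, eval y (Matrix.of fun a b : κ => ∑ i, C (L a i) * f b i).det =
      (Matrix.of fun a b : κ => ∑ i, L a i * eval y (f b i)).det := by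
    intro y
    rw [RingHom.map_det]
    congr 1
    ext a b
    simp
  refine ⟨(Matrix.of fun a b : κ => ∑ i, C (L a i) * f b i).det, ?_, fun y hy => ?_⟩
  rotate_left
  · rw [key] at hy
    rw [Fintype.linearIndependent_iff]
    intro g hg
    refine congrFun (Matrix.eq_zero_of_mulVec_eq_zero hy (v := g) ?_)
    ext a
    have h1 : ∀ i, ∑ b, g b * eval y (f b i) = 0 := fun i => by
      simpa using congrFun hg i
    simp only [Matrix.mulVec, dotProduct, Matrix.of_apply, Pi.zero_apply, Finset.sum_mul]
    rw [Finset.sum_comm]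
    calc ∑ i, ∑ b, L a i * eval y (f b i) * g b = ∑ i, L a i * ∑ b, g b * eval y (f b i) := by
          refine Finset.sum_congr rfl fun i _ => ?_
          rw [Finset.mul_sum]
          exact Finset.sum_congr rfl fun b _ => by ring
      _ = 0 := by simp [h1]
  · rw [key, show (Matrix.of fun a b : κ => ∑ i, L a i * eval y₀ (f b i)) = 1 from ?_]
    · simp
    · ext a b
      simp [hL, Matrix.one_apply]

/-- A polynomial family of fewer vectors than the dimension, independent at a point, has a
polynomial normal vector that does not vanish at that point. -/
lemma exists_polynomial_normal [Fintype ι] [Fintype κ] (hc : Fintype.card κ < Fintype.card ι)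
    (f : κ → ι → MvPolynomial τ ℂ)
    (y₀ : τ → ℂ) (h : LinearIndependent ℂ fun k i => eval y₀ (f k i)) :
    ∃ n : ι → MvPolynomial τ ℂ, (∀ k, ∑ i, n i * f k i = 0) ∧ ∃ i, eval y₀ (n i) ≠ 0 := by
  classical
  obtain ⟨e, he⟩ : ∃ e : ι → ℂ, e ∉ Submodule.span ℂ (Set.range fun k i => eval y₀ (f k i)) := by
    by_contra! H
    have h1 := finrank_span_eq_card h
    rw [(Submodule.eq_top_iff').2 H, finrank_top, Module.finrank_fintype_fun_eq_card] at h1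
    omega
  let f' : Option κ → ι → MvPolynomial τ ℂ := fun o => o.elim (fun i => C (e i)) f
  have h' : LinearIndependent ℂ fun k i => eval y₀ (f' k i) := by
    rw [linearIndependent_option]
    exact ⟨h, by simpa [f', Function.comp_def] using he⟩
  obtain ⟨L, hL⟩ := exists_dual_family _ h'
  let N : Matrix (Option κ) (Option κ) (MvPolynomial τ ℂ) :=
    Matrix.of fun a b => ∑ i, C (L a i) * f' b i
  have hN : ∀ b, ∑ i, (∑ a, N.adjugate none a * C (L a i)) * f' b i =
      if none = b then N.det else 0 := by
    intro b
    have := congrFun (congrFun (Matrix.adjugate_mul N) none) b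
    rw [Matrix.mul_apply] at this
    simp only [Matrix.smul_apply, Matrix.one_apply, smul_eq_mul, mul_ite, mul_one, mul_zero] at this
    rw [← this]
    simp only [N, Matrix.of_apply, Finset.sum_mul, Finset.mul_sum, mul_assoc]
    exact Finset.sum_comm
  refine ⟨fun i => ∑ a, N.adjugate none a * C (L a i), fun k => by simpa [f'] using hN (some k), ?_⟩
  by_contra! H
  have h2 := congrArg (eval y₀) (hN none)
  rw [map_sum] at h2
  simp only [map_mul, H, zero_mul, Finset.sum_const_zero, if_true] at h2
  rw [RingHom.map_det, show (eval y₀).mapMatrix N = 1 from ?_] at h2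
  · simp at h2
  · ext a b
    simp [N, hL, Matrix.one_apply]

/-- The space of normals to a hyperplane is a line. -/
lemma exists_smul_of_normal [Fintype ι] [Fintype κ] (hc : Fintype.card ι = Fintype.card κ + 1)
    {f : κ → ι → ℂ} (hf : LinearIndependent ℂ f) {n n' : ι → ℂ} (hn : n ≠ 0)
    (h : ∀ k, ∑ i, n i * f k i = 0) (h' : ∀ k, ∑ i, n' i * f k i = 0) :
    ∃ c : ℂ, n' = c • n := by
  classical
  let M : Matrix κ ι ℂ := Matrix.of f
  have hr : Module.finrank ℂ (LinearMap.ker M.mulVecLin) = 1 := by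
    have h1 := LinearMap.finrank_range_add_finrank_ker M.mulVecLin
    have h2 : M.rank = Fintype.card κ := LinearIndependent.rank_matrix (M := M) hf
    rw [Matrix.rank] at h2
    rw [h2, Module.finrank_fintype_fun_eq_card] at h1
    omega
  have mem : ∀ {m : ι → ℂ}, (∀ k, ∑ i, m i * f k i = 0) → m ∈ LinearMap.ker M.mulVecLin := by
    intro m hm
    rw [LinearMap.mem_ker]
    ext k
    simpa [M, Matrix.mulVec, dotProduct, mul_comm] using hm k
  obtain ⟨c, hc⟩ := exists_smul_eq_of_finrank_eq_one hr (x := ⟨n, mem h⟩)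
    (fun h0 => hn (congrArg Subtype.val h0)) ⟨n', mem h'⟩
  exact ⟨c, (congrArg Subtype.val hc).symm⟩

/-- An independent family of the right size spans the hyperplane containing it. -/
lemma exists_eq_sum_of_normal [Fintype ι] [Fintype κ] (hc : Fintype.card ι = Fintype.card κ + 1)
    {f : κ → ι → ℂ} (hf : LinearIndependent ℂ f) {n u : ι → ℂ} (hn : n ≠ 0)
    (h : ∀ k, ∑ i, n i * f k i = 0) (hu : ∑ i, n i * u i = 0) :
    ∃ ξ : κ → ℂ, ∑ k, ξ k • f k = u := by
  classical
  rw [← Submodule.mem_span_range_iff_exists_fun]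
  by_contra hnot
  have hi : LinearIndependent ℂ (fun o : Option κ => o.elim u f) := by
    rw [linearIndependent_option]
    exact ⟨hf, by simpa [Function.comp_def] using hnot⟩
  have hs := hi.span_eq_top_of_card_eq_finrank' (by simp [hc])
  let ℓ : (ι → ℂ) →ₗ[ℂ] ℂ := Fintype.linearCombination ℂ n
  have h0 : ℓ = 0 := by
    refine LinearMap.ext_on_range hs fun o => ?_
    cases o with
    | none => simpa [ℓ, Fintype.linearCombination_apply, mul_comm] using hu
    | some k => simpa [ℓ, Fintype.linearCombination_apply, mul_comm] using h k
  refine hn (funext fun i => ?_)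
  simpa [ℓ, Fintype.linearCombination_apply, Pi.single_apply] using
    LinearMap.congr_fun h0 (Pi.single i 1)

end GeneralAlgebra

section SegreChart

open MvPolynomial

/-- Coordinate indices of tensors in `⨂^6 ℂ²`. -/
abbrev Idx := Fin 6 → Fin 2

/-- Coordinates of the affine chart for sums of nine decomposable tensors: nine scalars and
`9 × 6` affine coordinates on `ℙ¹`. -/
abbrev Par := Fin 9 ⊕ (Fin 9 × Fin 6)

variable {B B' : Type} [CommRing B] [CommRing B']

/-- The affine chart `a ↦ (1 - a, a)` of `ℙ¹`. -/
def chart (a : B) (b : Fin 2) : B := if b = 0 then 1 - a else a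

/-- The velocity of `chart`. -/
def dir (b : Fin 2) : B := if b = 0 then -1 else 1

/-- The `I`-coordinate of the `i`-th decomposable tensor, differentiated in the slots in `s`. -/
def term (y : Par → B) (i : Fin 9) (s : Finset (Fin 6)) (I : Idx) : B :=
  ∏ j, if j ∈ s then dir (I j) else chart (y (Sum.inr (i, j))) (I j)

/-- The sum of nine decomposable tensors with chart coordinates `y`. -/
def seg (y : Par → B) (I : Idx) : B := ∑ i, y (Sum.inl i) * term y i ∅ I

/-- The first derivatives of `seg`. -/
def tan (y : Par → B) : Par → Idx → B
  | Sum.inl i, I => term y i ∅ I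
  | Sum.inr (i, j), I => y (Sum.inl i) * term y i {j} I

/-- The second derivatives of `seg`. -/
def hes (y : Par → B) : Par → Par → Idx → B
  | Sum.inl _, Sum.inl _, _ => 0
  | Sum.inl i, Sum.inr (i', j), I => if i = i' then term y i {j} I else 0
  | Sum.inr (i', j), Sum.inl i, I => if i = i' then term y i {j} I else 0
  | Sum.inr (i, j), Sum.inr (i', j'), I =>
      if i = i' ∧ j ≠ j' then y (Sum.inl i) * term y i {j, j'} I else 0

lemma map_chart (f : B →+* B') (a : B) (b : Fin 2) : f (chart a b) = chart (f a) b := by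
  unfold chart; split_ifs <;> simp

lemma map_dir (f : B →+* B') (b : Fin 2) : f (dir b) = dir b := by
  unfold dir; split_ifs <;> simp

lemma map_term (f : B →+* B') (y : Par → B) (i s I) :
    f (term y i s I) = term (fun a => f (y a)) i s I := by
  unfold term
  rw [map_prod]
  refine Finset.prod_congr rfl fun j _ => ?_
  split_ifs
  · exact map_dir f _
  · exact map_chart f _ _

lemma map_seg (f : B →+* B') (y : Par → B) (I) : f (seg y I) = seg (fun a => f (y a)) I := by
  simp [seg, map_term]

lemma map_tan (f : B →+* B') (y : Par → B) (a I) :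
    f (tan y a I) = tan (fun a => f (y a)) a I := by
  rcases a with i | ⟨i, j⟩ <;> simp [tan, map_term]

lemma map_hes (f : B →+* B') (y : Par → B) (a b I) :
    f (hes y a b I) = hes (fun a => f (y a)) a b I := by
  rcases a with i | ⟨i, j⟩ <;> rcases b with i' | ⟨i', j'⟩ <;> simp only [hes] <;>
    first | exact map_zero f | (split_ifs <;> simp [map_term])

lemma hes_comm (y : Par → B) (a b I) : hes y a b I = hes y b a I := by
  rcases a with i | ⟨i, j⟩ <;> rcases b with i' | ⟨i', j'⟩ <;> simp only [hes]
  by_cases h : i = i'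
  · subst h
    simp only [Finset.pair_comm j j', ne_comm]
  · rw [if_neg (fun h' => h h'.1), if_neg (fun h' => h h'.1.symm)]

lemma pderiv_prod_eq_zero {τ κ : Type} (s : Finset κ) (f : κ → MvPolynomial τ ℂ) (a : τ)
    (h : ∀ k ∈ s, pderiv a (f k) = 0) : pderiv a (∏ k ∈ s, f k) = 0 := by
  classical
  induction s using Finset.induction_on with
  | empty => simp
  | insert k s hk ih =>
    rw [Finset.prod_insert hk, pderiv_mul, h k (Finset.mem_insert_self _ _),
      ih fun l hl => h l (Finset.mem_insert_of_mem hl)]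
    simp

lemma pderiv_dir (a : Par) (b : Fin 2) : pderiv a (dir b : MvPolynomial Par ℂ) = 0 := by
  unfold dir; split_ifs <;> simp

lemma pderiv_chart (a c : Par) (b : Fin 2) :
    pderiv a (chart (X c : MvPolynomial Par ℂ) b) = if a = c then dir b else 0 := by
  unfold dir chart
  by_cases h : a = c
  · subst h; rw [if_pos rfl]; split_ifs <;> simp
  · rw [if_neg h]; split_ifs <;> simp [pderiv_X_of_ne (Ne.symm h)]

lemma pderiv_term (a : Par) (i : Fin 9) (s : Finset (Fin 6)) (I : Idx) :
    pderiv a (term (X : Par → MvPolynomial Par ℂ) i s I) =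
      Sum.elim (fun _ => 0)
        (fun p => if p.1 = i ∧ p.2 ∉ s then term X i (insert p.2 s) I else 0) a := by
  by_cases h : ∃ j, j ∉ s ∧ a = Sum.inr (i, j)
  · obtain ⟨j, hj, rfl⟩ := h
    simp only [Sum.elim_inr, hj, not_false_eq_true, and_self, if_true]
    unfold term
    rw [← Finset.mul_prod_erase Finset.univ _ (Finset.mem_univ j), pderiv_mul,
      ← Finset.mul_prod_erase Finset.univ _ (Finset.mem_univ j), pderiv_prod_eq_zero]
    · simp only [hj, if_false, pderiv_chart, if_true, mul_zero, add_zero, Finset.mem_insert_self]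
      congr 1
      refine Finset.prod_congr rfl fun k hk => ?_
      simp [Finset.ne_of_mem_erase hk]
    · intro k hk
      split_ifs
      · exact pderiv_dir _ _
      · rw [pderiv_chart, if_neg]
        simpa using (Finset.ne_of_mem_erase hk).symm
  · have h0 : pderiv a (term (X : Par → MvPolynomial Par ℂ) i s I) = 0 := by
      refine pderiv_prod_eq_zero _ _ _ fun k _ => ?_
      split_ifs with hk
      · exact pderiv_dir _ _
      · rw [pderiv_chart, if_neg fun h' => h ⟨k, hk, h'⟩]
    rw [h0]
    rcases a with i' | ⟨i', j⟩
    · rfl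
    · rw [Sum.elim_inr, if_neg]
      rintro ⟨h1, h2⟩
      exact h ⟨j, h2, by rw [← h1]⟩

lemma pderiv_seg (a : Par) (I : Idx) :
    pderiv a (seg (X : Par → MvPolynomial Par ℂ) I) = tan X a I := by
  simp only [seg, map_sum, pderiv_mul, pderiv_term]
  rcases a with i | ⟨i, j⟩
  · simp [tan, pderiv_X, Pi.single_apply]
  · simp [tan, pderiv_X]

lemma pderiv_tan (a b : Par) (I : Idx) :
    pderiv a (tan (X : Par → MvPolynomial Par ℂ) b I) = hes X a b I := by
  rcases a with i | ⟨i, j⟩ <;> rcases b with i' | ⟨i', j'⟩ <;>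
    simp only [tan, hes, pderiv_mul, pderiv_term, Sum.elim_inl, Sum.elim_inr, mul_zero, add_zero]
  · by_cases h : i = i'
    · subst h; simp
    · rw [pderiv_X_of_ne (by simpa using Ne.symm h)]; simp [h]
  · by_cases h : i = i'
    · subst h; simp
    · simp [h, Ne.symm h]
  · rw [pderiv_X_of_ne (by simp)]
    by_cases h : i = i'
    · subst h; simp
    · simp [h]

end SegreChart

section BasePoint

/-- The words of a binary `[6, 3, 3]` code, indexed by `0, …, 7`. -/
def codeword (k : ℕ) : Idx :=
  let a := Fin.ofNat 2 k
  let b := Fin.ofNat 2 (k / 2)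
  let c := Fin.ofNat 2 (k / 4)
  ![a, b, c, a + b, b + c, a + b + c]

/-- The word `w` with the bits at the positions `0` and `2` flipped; it is at distance two from
the code if `w` is a codeword. -/
def farWord (k : ℕ) : Idx := fun j => codeword k j + if j = 0 ∨ j = 2 then 1 else 0

/-- The `k`-th codeword with the `j`-th bit flipped. -/
def flipWord (k : ℕ) (j : Fin 6) : Idx := fun j' => codeword k j' + if j' = j then 1 else 0

/-- The base point: the coordinate points of the codewords, and the point `(2, -1)^{⊗ 6}`. -/
def base : Par → ℤ
  | Sum.inl _ => 1
  | Sum.inr (i, j) => if i = 8 then -1 else (codeword i j : ℕ)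

/-- A sign character. -/
def sgn (b : Fin 2) : ℤ := if b = 0 then 1 else -1

/-- The reciprocals, up to scale, of the coordinates of `(2, -1)^{⊗ 6}`. -/
def weight (I : Idx) : ℤ := ∏ j, if I j = 0 then 1 else -2

/-- The hyperplane tangent to the Segre variety at the nine points given by `base`. -/
def baseNormal (I : Idx) : ℤ :=
  if I 3 = I 0 + I 1 + 1 ∧ I 4 = I 1 + I 2 + 1 ∧ I 5 = I 0 + I 1 + I 2 then
    sgn (I 0) * sgn (I 2) * weight I else 0

/-- The fixed-point-free involution of the slots attached to the coset of `farWord`. -/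
def mate : Fin 6 → Fin 6 := ![2, 5, 0, 4, 3, 1]

lemma mate_mate (j : Fin 6) : mate (mate j) = j := by
  revert j; decide

lemma farWord_slot (j : Fin 6) (b : Par) :
    ∑ k : Fin 8, sgn (farWord k j) * weight (farWord k) * tan base b (farWord k) =
      if b = Sum.inr (8, j) then 128 else 0 := by
  revert j b; decide +kernel

lemma farWord_scalar (b : Par) :
    ∑ k : Fin 8, (1 + 3 * ∑ j, sgn (farWord k j)) * weight (farWord k) * tan base b (farWord k) =
      if b = Sum.inl 8 then 512 else 0 := by
  revert b; decide +kernel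

lemma tan_flipWord (i : Fin 8) (j : Fin 6) (b : Par)
    (h : tan base b (flipWord i j) ≠ 0) :
    b = Sum.inr (i.castSucc, j) ∨ b = Sum.inl 8 ∨ ∃ j', b = Sum.inr (8, j') := by
  revert i j b; decide +kernel

lemma tan_flipWord_self (i : Fin 8) (j : Fin 6) :
    tan base (Sum.inr (i.castSucc, j)) (flipWord i j) ≠ 0 := by
  revert i j; decide +kernel

lemma tan_codeword (i : Fin 8) (b : Par) (h : tan base b (codeword i) ≠ 0) :
    b = Sum.inl i.castSucc ∨ b = Sum.inl 8 ∨ ∃ p, b = Sum.inr p := by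
  revert i b; decide +kernel

lemma tan_codeword_self (i : Fin 8) : tan base (Sum.inl i.castSucc) (codeword i) ≠ 0 := by
  revert i; decide +kernel

lemma farWord_injective : Function.Injective fun k : Fin 8 => farWord k := by
  have h : ∀ k l : Fin 8, farWord k = farWord l → k = l := by decide +kernel
  exact fun k l => h k l

lemma baseNormal_eq_zero (I : Idx) (h : ∀ k : Fin 8, farWord k ≠ I) : baseNormal I = 0 := by
  revert I; decide +kernel

lemma sum_baseNormal_mul (f : Idx → ℤ) :
    ∑ I, baseNormal I * f I = ∑ k : Fin 8, baseNormal (farWord k) * f (farWord k) :=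
  (Fintype.sum_of_injective _ farWord_injective _ _
    (fun I hI => by rw [baseNormal_eq_zero I fun k hk => hI ⟨k, hk⟩, zero_mul])
    fun _ => rfl).symm

lemma baseNormal_tan (b : Par) : ∑ I, baseNormal I * tan base b I = 0 := by
  rw [sum_baseNormal_mul]
  revert b; decide +kernel

lemma baseNormal_ne_zero : baseNormal (farWord 0) ≠ 0 := by
  decide +kernel

lemma baseNormal_hes (i : Fin 9) (j j' : Fin 6) :
    ∑ I, baseNormal I * hes base (Sum.inr (i, j)) (Sum.inr (i, j')) I ≠ 0 ↔ j = mate j' := by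
  rw [sum_baseNormal_mul]
  revert i j j'; decide +kernel

end BasePoint

section Genericity

open MvPolynomial

/-- The base point, as a complex point. -/
def baseC (a : Par) : ℂ := (base a : ℂ)

lemma tan_baseC (a I) : tan baseC a I = ((tan base a I : ℤ) : ℂ) :=
  (map_tan (Int.castRingHom ℂ) base a I).symm

lemma hes_baseC (a b I) : hes baseC a b I = ((hes base a b I : ℤ) : ℂ) :=
  (map_hes (Int.castRingHom ℂ) base a b I).symm

lemma linearIndependent_tan_baseC : LinearIndependent ℂ (tan baseC) := by
  rw [Fintype.linearIndependent_iff]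
  intro g hg
  have hI : ∀ I, ∑ b, g b * ((tan base b I : ℤ) : ℂ) = 0 := fun I => by
    simpa [tan_baseC] using congrFun hg I
  have comb : ∀ (w : Fin 8 → ℤ) (a : Par) (d : ℤ), d ≠ 0 →
      (∀ b, ∑ k : Fin 8, w k * tan base b (farWord k) = if b = a then d else 0) → g a = 0 := by
    intro w a d hd h
    have h1 : ∑ k : Fin 8, (w k : ℂ) * ∑ b, g b * ((tan base b (farWord k) : ℤ) : ℂ) = 0 := by
      simp [hI]
    simp only [Finset.mul_sum] at h1
    rw [Finset.sum_comm] at h1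
    have h2 : ∀ b, ∑ k : Fin 8, (w k : ℂ) * (g b * ((tan base b (farWord k) : ℤ) : ℂ)) =
        g b * ((if b = a then d else 0 : ℤ) : ℂ) := by
      intro b
      rw [← h b]
      push_cast
      rw [Finset.mul_sum]
      exact Finset.sum_congr rfl fun k _ => by ring
    simp only [h2] at h1
    simpa [hd] using h1
  have single : ∀ (a : Par) (I : Idx), tan base a I ≠ 0 →
      (∀ b, tan base b I ≠ 0 → b = a ∨ g b = 0) → g a = 0 := by
    intro a I ha h
    have h1 := hI I
    rw [Finset.sum_eq_single a] at h1
    · simpa [ha] using h1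
    · intro b _ hb
      by_cases h0 : tan base b I = 0
      · simp [h0]
      · simp [(h b h0).resolve_left hb]
    · simp
  have g1 : g (Sum.inl 8) = 0 := comb _ _ 512 (by norm_num) farWord_scalar
  have g2 : ∀ j, g (Sum.inr (8, j)) = 0 := fun j => comb _ _ 128 (by norm_num) (farWord_slot j)
  have g3 : ∀ i j, g (Sum.inr (i, j)) = 0 := by
    intro i j
    induction i using Fin.lastCases with
    | last => exact g2 j
    | cast i =>
      refine single _ _ (tan_flipWord_self i j) fun b hb => ?_
      rcases tan_flipWord i j b hb with rfl | rfl | ⟨j', rfl⟩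
      · exact Or.inl rfl
      · exact Or.inr g1
      · exact Or.inr (g2 j')
  rintro (i | ⟨i, j⟩)
  · induction i using Fin.lastCases with
    | last => exact g1
    | cast i =>
      refine single _ _ (tan_codeword_self i) fun b hb => ?_
      rcases tan_codeword i b hb with rfl | rfl | ⟨⟨i', j'⟩, rfl⟩
      · exact Or.inl rfl
      · exact Or.inr g1
      · exact Or.inr (g3 i' j')
  · exact g3 i j

lemma linearIndependent_hes_baseC {n : Idx → ℂ} (hn : n ≠ 0)
    (h : ∀ a, ∑ I, n I * tan baseC a I = 0) :
    LinearIndependent ℂ fun p q : Fin 9 × Fin 6 =>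
      ∑ I, n I * hes baseC (Sum.inr p) (Sum.inr q) I := by
  obtain ⟨c, hc⟩ := exists_smul_of_normal (n := fun I => (baseNormal I : ℂ)) (n' := n)
    (by simp) linearIndependent_tan_baseC
    (fun h0 => baseNormal_ne_zero (by simpa using congrFun h0 (farWord 0)))
    (fun a => by
      simp only [tan_baseC]
      exact_mod_cast baseNormal_tan a) h
  have hc0 : c ≠ 0 := by
    rintro rfl
    exact hn (by simpa using hc)
  have hQ : ∀ i j j', (∑ I, n I * hes baseC (Sum.inr (i, j)) (Sum.inr (i, j')) I ≠ 0) ↔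
      j = mate j' := by
    intro i j j'
    rw [← baseNormal_hes i j j', hc]
    simp only [hes_baseC, Pi.smul_apply, smul_eq_mul, mul_assoc, ← Finset.mul_sum]
    rw [mul_ne_zero_iff, and_iff_right hc0]
    norm_cast
  have hQ' : ∀ i i' j j', i ≠ i' →
      ∑ I, n I * hes baseC (Sum.inr (i, j)) (Sum.inr (i', j')) I = 0 := by
    intro i i' j j' hi
    simp [hes, hi]
  rw [Fintype.linearIndependent_iff]
  rintro g hg ⟨i, j⟩
  have h1 := congrFun hg (i, mate j)
  have hm := mate_mate j
  simp only [Finset.sum_apply, Pi.smul_apply, smul_eq_mul, Pi.zero_apply] at h1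
  rw [Finset.sum_eq_single (i, j)] at h1
  · exact (mul_eq_zero.1 h1).resolve_right ((hQ i j (mate j)).2 hm.symm)
  · rintro ⟨i', j'⟩ _ hne
    by_cases hi : i' = i
    · subst hi
      have : ¬ (∑ I, n I * hes baseC (Sum.inr (i', j')) (Sum.inr (i', mate j)) I ≠ 0) := by
        rw [hQ, hm]
        rintro rfl
        exact hne rfl
      rw [not_ne_iff.1 this, mul_zero]
    · rw [hQ' _ _ _ _ hi, mul_zero]
  · simp

/-- The open conditions on chart coordinates under which decompositions are unique. -/
structure Good (y : Par → ℂ) : Prop where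
  scalar_ne_zero : ∀ i, y (Sum.inl i) ≠ 0
  linearIndependent_tan : LinearIndependent ℂ (tan y)
  linearIndependent_hes : ∀ n : Idx → ℂ, n ≠ 0 → (∀ a, ∑ I, n I * tan y a I = 0) →
    LinearIndependent ℂ fun p q : Fin 9 × Fin 6 => ∑ I, n I * hes y (Sum.inr p) (Sum.inr q) I
  slot_injective : ∀ i k, y (Sum.inr (i, 0)) = y (Sum.inr (k, 0)) → i = k

lemma eval_tan_X (y : Par → ℂ) (a I) : eval y (tan X a I) = tan y a I := by
  simp [map_tan]

lemma eval_hes_X (y : Par → ℂ) (a b I) : eval y (hes X a b I) = hes y a b I := by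
  simp [map_hes]

lemma eval_seg_X (y : Par → ℂ) (I) : eval y (seg X I) = seg y I := by
  simp [map_seg]

lemma exists_good : ∃ q : MvPolynomial Par ℂ, q ≠ 0 ∧ ∀ y, eval y q ≠ 0 → Good y := by
  have hX : (fun (k : Par) (I : Idx) => eval baseC (tan (X : Par → MvPolynomial Par ℂ) k I)) =
      tan baseC := by
    ext; exact eval_tan_X _ _ _
  obtain ⟨q₁, hq₁, H₁⟩ := exists_linearIndependent_of_eval (τ := Par) (tan X) baseC
    (hX ▸ linearIndependent_tan_baseC)
  obtain ⟨n, hn, I₀, hI₀⟩ := exists_polynomial_normal (τ := Par) (by simp) (tan X) baseC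
    (hX ▸ linearIndependent_tan_baseC)
  have hn' : ∀ y a, ∑ I, eval y (n I) * tan y a I = 0 := by
    intro y a
    simpa [eval_tan_X] using congrArg (eval y) (hn a)
  obtain ⟨q₂, hq₂, H₂⟩ := exists_linearIndependent_of_eval (τ := Par)
    (fun p q : Fin 9 × Fin 6 => ∑ I, n I * hes X (Sum.inr p) (Sum.inr q) I) baseC (by
      simp only [map_sum, map_mul, eval_hes_X]
      exact linearIndependent_hes_baseC (fun h0 => hI₀ (congrFun h0 I₀)) (hn' baseC))
  have ne0 : ∀ {q : MvPolynomial Par ℂ}, eval baseC q ≠ 0 → q ≠ 0 := by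
    rintro q hq rfl
    simp at hq
  refine ⟨q₁ * q₂ * n I₀ * (∏ i : Fin 9, X (Sum.inl i)) *
    ∏ p ∈ (Finset.univ : Finset (Fin 9)).offDiag, (X (Sum.inr (p.1, 0)) - X (Sum.inr (p.2, 0))),
    ?_, ?_⟩
  · refine mul_ne_zero (mul_ne_zero (mul_ne_zero (mul_ne_zero (ne0 hq₁) (ne0 hq₂)) (ne0 hI₀)) ?_) ?_
    · exact Finset.prod_ne_zero_iff.2 fun i _ => X_ne_zero _
    · refine Finset.prod_ne_zero_iff.2 fun p hp => sub_ne_zero.2 fun h => ?_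
      have := X_injective h
      simp at this
      exact (Finset.mem_offDiag.1 hp).2.2 this
  · intro y hy
    simp only [map_mul, map_prod, map_sub, eval_X] at hy
    obtain ⟨⟨⟨⟨h1, h2⟩, h3⟩, h4⟩, h5⟩ := by simpa only [mul_ne_zero_iff] using hy
    have ht : LinearIndependent ℂ (tan y) := by
      simpa only [eval_tan_X] using H₁ y h1
    refine ⟨fun i => Finset.prod_ne_zero_iff.1 h4 i (Finset.mem_univ _), ht, ?_, ?_⟩
    · intro m hm hmt
      obtain ⟨c, hc⟩ := exists_smul_of_normal (by simp) ht (n := m) (n' := fun I => eval y (n I)) hm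
        hmt (hn' y)
      have hc0 : c ≠ 0 := by
        rintro rfl
        exact h3 (by simpa using congrFun hc I₀)
      have h6 := H₂ y h2
      rw [Fintype.linearIndependent_iff] at h6 ⊢
      intro g hg
      refine h6 g ?_
      ext q
      have h7 := congrFun hg q
      simp only [Finset.sum_apply, Pi.smul_apply, smul_eq_mul, Pi.zero_apply, map_sum, map_mul,
        eval_hes_X] at h7 ⊢
      simp only [fun I => (congrFun hc I : eval y (n I) = _), Pi.smul_apply, smul_eq_mul,
        mul_assoc, ← Finset.mul_sum, mul_left_comm _ c, h7, mul_zero]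
    · intro i k hik
      by_contra hne
      exact Finset.prod_ne_zero_iff.1 h5 (i, k)
        (Finset.mem_offDiag.2 ⟨Finset.mem_univ _, Finset.mem_univ _, hne⟩) (sub_eq_zero.2 hik)

end Genericity

section Uniqueness

open MvPolynomial

/-- The equation and its gradient along the secant variety, differentiated once. -/
lemma sum_pderiv_mul_tan {G : MvPolynomial Idx ℂ}
    (hG : aeval (seg (X : Par → MvPolynomial Par ℂ)) G = 0) (a : Par) :
    ∑ I, aeval (seg (X : Par → MvPolynomial Par ℂ)) (pderiv I G) * tan X a I = 0 := by
  have := pderiv_aeval (seg (X : Par → MvPolynomial Par ℂ)) G a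
  simpa only [hG, map_zero, pderiv_seg, eq_comm] using this

lemma eval_aeval_seg (y : Par → ℂ) (F : MvPolynomial Idx ℂ) :
    eval y (aeval (seg (X : Par → MvPolynomial Par ℂ)) F) = eval (seg y) F := by
  have h : (fun I => eval y (seg (X : Par → MvPolynomial Par ℂ) I)) = seg y :=
    funext (eval_seg_X y)
  rw [← h, ← coe_aeval_eq_eval, ← coe_aeval_eq_eval]
  exact (MvPolynomial.comp_aeval_apply _ (aeval y) F)

lemma sum_gradient_mul_tan {G : MvPolynomial Idx ℂ}
    (hG : aeval (seg (X : Par → MvPolynomial Par ℂ)) G = 0) (y : Par → ℂ) (a : Par) :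
    ∑ I, eval (seg y) (pderiv I G) * tan y a I = 0 := by
  simpa only [map_sum, map_mul, eval_aeval_seg, eval_tan_X, map_zero] using
    congrArg (eval y) (sum_pderiv_mul_tan hG a)

lemma sum_hessian_mul_tan_tan {G : MvPolynomial Idx ℂ}
    (hG : aeval (seg (X : Par → MvPolynomial Par ℂ)) G = 0) (y : Par → ℂ) (a b : Par) :
    ∑ J, (∑ I, eval (seg y) (pderiv J (pderiv I G)) * tan y b I) * tan y a J +
      ∑ I, eval (seg y) (pderiv I G) * hes y a b I = 0 := by
  have h := congrArg (eval y) (congrArg (pderiv a) (sum_pderiv_mul_tan hG b))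
  simp only [map_sum, pderiv_mul, pderiv_aeval, pderiv_seg, pderiv_tan, map_add, map_mul,
    eval_aeval_seg, eval_tan_X, eval_hes_X, map_zero, Finset.sum_add_distrib] at h
  rw [← h]
  refine congrArg (· + _) ?_
  simp only [Finset.sum_mul]
  rw [Finset.sum_comm]
  exact Finset.sum_congr rfl fun I _ => Finset.sum_congr rfl fun J _ => mul_right_comm _ _ _

lemma sum_chart (a : ℂ) : ∑ b, chart a b = 1 := by
  simp [chart]

lemma sum_term (y : Par → ℂ) (i : Fin 9) : ∑ I, term y i ∅ I = 1 := by
  have h : ∀ I, term y i ∅ I = ∏ j, chart (y (Sum.inr (i, j))) (I j) := fun I => by simp [term]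
  simp only [h]
  have h' := Finset.prod_univ_sum (fun _ : Fin 6 => (Finset.univ : Finset (Fin 2)))
    (fun j b => chart (y (Sum.inr (i, j))) b)
  rw [Fintype.piFinset_univ] at h'
  rw [← h']
  exact Finset.prod_eq_one fun j _ => sum_chart _

lemma term_update_zero (y : Par → ℂ) (i : Fin 9) (I : Idx) (b : Fin 2) :
    term y i ∅ (Function.update I 0 b) =
      chart (y (Sum.inr (i, 0))) b * ∏ j : Fin 5, chart (y (Sum.inr (i, j.succ))) (I j.succ) := by
  simp [term, Fin.prod_univ_succ, Function.update_apply, Fin.succ_ne_zero]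

lemma term_singleton_zero (y : Par → ℂ) (i : Fin 9) (I : Idx) :
    term y i {0} I =
      dir (I 0) * ∏ j : Fin 5, chart (y (Sum.inr (i, j.succ))) (I j.succ) := by
  simp [term, Fin.prod_univ_succ, Fin.succ_ne_zero]

/-- A decomposable tensor in the span of the nine given ones is one of them. -/
lemma eq_term_of_eq_sum {y y' : Par → ℂ} (hy : Good y) (i : Fin 9) (c : Fin 9 → ℂ)
    (h : ∀ I, term y' i ∅ I = ∑ k, c k * term y k ∅ I) : ∃ k, term y' i ∅ = term y k ∅ := by
  set t := y' (Sum.inr (i, 0)) with ht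
  have h1 : ∀ k, c k * (t - y (Sum.inr (k, 0))) = 0 := by
    have hl := hy.linearIndependent_tan.comp (fun k : Fin 9 => (Sum.inr (k, 0) : Par))
      (fun a b hab => by simpa using hab)
    rw [Fintype.linearIndependent_iff] at hl
    intro k
    have h2 := hl (fun k => c k * (t - y (Sum.inr (k, 0))) / y (Sum.inl k)) ?_ k
    · exact (div_eq_zero_iff.1 h2).resolve_right (hy.scalar_ne_zero k)
    · ext I
      have e0 := h (Function.update I 0 0)
      have e1 := h (Function.update I 0 1)
      simp only [term_update_zero, ← ht] at e0 e1
      simp only [Function.comp_def, Finset.sum_apply, Pi.smul_apply, smul_eq_mul, tan,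
        term_singleton_zero, Pi.zero_apply]
      have e2 : dir (I 0) * (t * ∑ k, c k * (chart (y (Sum.inr (k, 0))) 0 *
          ∏ j : Fin 5, chart (y (Sum.inr (k, j.succ))) (I j.succ)) -
          (1 - t) * ∑ k, c k * (chart (y (Sum.inr (k, 0))) 1 *
          ∏ j : Fin 5, chart (y (Sum.inr (k, j.succ))) (I j.succ))) = 0 := by
        rw [← e0, ← e1]
        simp [chart]
        right; ring
      rw [Finset.mul_sum, Finset.mul_sum, ← Finset.sum_sub_distrib, Finset.mul_sum] at e2
      rw [← e2]
      refine Finset.sum_congr rfl fun k _ => ?_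
      have := hy.scalar_ne_zero k
      simp only [chart, if_true, one_ne_zero, if_false]
      field_simp
      ring
  have h3 : ∃ k, c k ≠ 0 := by
    by_contra! H
    have h4 := sum_term y' i
    simp [h, H] at h4
  obtain ⟨k, hk⟩ := h3
  have hck : ∀ l, l ≠ k → c l = 0 := by
    intro l hl
    by_contra hcl
    refine hl (hy.slot_injective l k ?_)
    rw [← sub_eq_zero.1 ((mul_eq_zero.1 (h1 k)).resolve_left hk),
      sub_eq_zero.1 ((mul_eq_zero.1 (h1 l)).resolve_left hcl)]
  have h5 : ∀ I, term y' i ∅ I = c k * term y k ∅ I := fun I => by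
    rw [h I, Finset.sum_eq_single k (fun l _ hl => by rw [hck l hl, zero_mul]) (by simp)]
  have h6 : c k = 1 := by
    have h7 := sum_term y' i
    simpa only [h5, ← Finset.mul_sum, sum_term, mul_one] using h7
  exact ⟨k, funext fun I => by rw [h5, h6, one_mul]⟩

/-- If two good points have the same image at which the equation `G` has nonzero gradient, each
decomposable tensor of the second lies in the span of those of the first. -/
lemma exists_term_eq_sum {G : MvPolynomial Idx ℂ}
    (hG : aeval (seg (X : Par → MvPolynomial Par ℂ)) G = 0) {y y' : Par → ℂ}
    (hy : Good y) (hy' : Good y') (h : seg y' = seg y)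
    (hn : (fun I => eval (seg y) (pderiv I G)) ≠ 0) (i : Fin 9) :
    ∃ c : Fin 9 → ℂ, ∀ I, term y' i ∅ I = ∑ k, c k * term y k ∅ I := by
  set n := fun I => eval (seg y) (pderiv I G) with hndef
  have F1 : ∀ a, ∑ I, n I * tan y a I = 0 := sum_gradient_mul_tan hG y
  have F1' : ∀ a, ∑ I, n I * tan y' a I = 0 := fun a => by
    have := sum_gradient_mul_tan hG y' a
    rwa [h] at this
  have hslot : ∀ {z : Par → ℂ}, Good z → (∀ a, ∑ I, n I * tan z a I = 0) →
      ∀ k j, ∑ I, n I * term z k {j} I = 0 := by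
    intro z hz hF k j
    have h1 := hF (Sum.inr (k, j))
    simp only [tan, mul_left_comm _ (z (Sum.inl k)), ← Finset.mul_sum] at h1
    exact (mul_eq_zero.1 h1).resolve_left (hz.scalar_ne_zero k)
  have hmix : ∀ {z : Par → ℂ}, Good z → (∀ a, ∑ I, n I * tan z a I = 0) →
      ∀ a k, ∑ I, n I * hes z a (Sum.inl k) I = 0 := by
    intro z hz hF a k
    rcases a with l | ⟨l, j⟩
    · simp [hes]
    · by_cases hkl : k = l
      · simp [hes, hkl, hslot hz hF]
      · simp [hes, hkl]
  obtain ⟨κ, hκ⟩ := exists_smul_of_normal (by simp) hy'.linearIndependent_tan hn F1'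
    (n' := fun J => ∑ I, eval (seg y) (pderiv J (pderiv I G)) * tan y' (Sum.inl i) I)
    (fun a => by
      have h1 := sum_hessian_mul_tan_tan hG y' a (Sum.inl i)
      rw [h] at h1
      rwa [hmix hy' F1' a i, add_zero] at h1)
  obtain ⟨ξ, hξ⟩ := exists_eq_sum_of_normal (by simp) hy.linearIndependent_tan hn F1
    (F1' (Sum.inl i))
  have hker : ∀ a, ∑ b, ξ b * ∑ I, n I * hes y a b I = 0 := by
    intro a
    have h1 : ∑ b, ξ b * ∑ J, (∑ I, eval (seg y) (pderiv J (pderiv I G)) * tan y b I) * tan y a J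
        = 0 := by
      calc _ = ∑ J, (∑ I, eval (seg y) (pderiv J (pderiv I G)) * tan y' (Sum.inl i) I) *
            tan y a J := by
            rw [← hξ]
            simp only [Finset.sum_apply, Pi.smul_apply, smul_eq_mul, Finset.mul_sum,
              Finset.sum_mul]
            rw [Finset.sum_comm]
            refine Finset.sum_congr rfl fun J _ => ?_
            rw [Finset.sum_comm]
            exact Finset.sum_congr rfl fun I _ => Finset.sum_congr rfl fun b _ => by ring
        _ = ∑ J, (κ * n J) * tan y a J :=
            Finset.sum_congr rfl fun J _ => by rw [congrFun hκ J]; rfl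
        _ = 0 := by
            simp only [mul_assoc, ← Finset.mul_sum, F1, mul_zero]
    have h2 : ∑ b, ξ b * (∑ J, (∑ I, eval (seg y) (pderiv J (pderiv I G)) * tan y b I) *
        tan y a J + ∑ I, n I * hes y a b I) = 0 :=
      Finset.sum_eq_zero fun b _ => by rw [sum_hessian_mul_tan_tan hG y a b, mul_zero]
    simpa only [mul_add, Finset.sum_add_distrib, h1, zero_add] using h2
  have hξ0 : ∀ p, ξ (Sum.inr p) = 0 := by
    have hl := hy.linearIndependent_hes n hn F1
    rw [Fintype.linearIndependent_iff] at hl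
    refine hl (fun p => ξ (Sum.inr p)) ?_
    ext q
    have h1 := hker (Sum.inr q)
    rw [Fintype.sum_sum_type] at h1
    simp only [hmix hy F1, mul_zero, Finset.sum_const_zero, zero_add] at h1
    simp only [Finset.sum_apply, Pi.smul_apply, smul_eq_mul, Pi.zero_apply]
    rw [← h1]
    exact Finset.sum_congr rfl fun p _ => by simp only [hes_comm y (Sum.inr q)]
  refine ⟨fun k => ξ (Sum.inl k), fun I => ?_⟩
  have h1 := congrFun hξ I
  rw [Finset.sum_apply, Fintype.sum_sum_type] at h1
  simp only [hξ0, Pi.smul_apply, zero_mul, Finset.sum_const_zero, add_zero, smul_eq_mul] at h1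
  exact h1.symm

lemma Good.linearIndependent_term {y : Par → ℂ} (hy : Good y) :
    LinearIndependent ℂ fun i => term y i ∅ :=
  hy.linearIndependent_tan.comp (fun k : Fin 9 => (Sum.inl k : Par)) Sum.inl_injective

/-- Two good points with the same image agree up to a permutation of the summands. -/
lemma exists_perm_of_seg_eq {G : MvPolynomial Idx ℂ}
    (hG : aeval (seg (X : Par → MvPolynomial Par ℂ)) G = 0) {y y' : Par → ℂ}
    (hy : Good y) (hy' : Good y') (h : seg y' = seg y)
    (hn : (fun I => eval (seg y) (pderiv I G)) ≠ 0) :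
    ∃ σ : Equiv.Perm (Fin 9), ∀ i,
      y' (Sum.inl i) = y (Sum.inl (σ i)) ∧ term y' i ∅ = term y (σ i) ∅ := by
  have h1 : ∀ i, ∃ k, term y' i ∅ = term y k ∅ := fun i => by
    obtain ⟨c, hc⟩ := exists_term_eq_sum hG hy hy' h hn i
    exact eq_term_of_eq_sum hy i c hc
  choose σ hσ using h1
  have hinj : Function.Injective σ := fun a b hab =>
    hy'.linearIndependent_term.injective (by simp only [hσ, hab])
  let e : Equiv.Perm (Fin 9) := Equiv.ofBijective σ (Finite.injective_iff_bijective.1 hinj)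
  refine ⟨e, fun i => ⟨?_, hσ i⟩⟩
  have hl := hy'.linearIndependent_term
  rw [Fintype.linearIndependent_iff] at hl
  refine sub_eq_zero.1 (hl (fun i => y' (Sum.inl i) - y (Sum.inl (e i))) ?_ i)
  ext I
  have h2 := congrFun h I
  simp only [seg] at h2
  rw [← Equiv.sum_comp e (fun i => y (Sum.inl i) * term y i ∅ I), ← sub_eq_zero,
    ← Finset.sum_sub_distrib] at h2
  simp only [Finset.sum_apply, Pi.smul_apply, smul_eq_mul, Pi.zero_apply]
  rw [← h2]
  refine Finset.sum_congr rfl fun k _ => ?_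
  rw [sub_mul, show term y' k ∅ I = term y (e k) ∅ I from congrFun (hσ k) I]

end Uniqueness

section Elimination

open MvPolynomial

lemma exists_linear_algebraicIndependent : ∃ l : Par → MvPolynomial Idx ℂ,
    AlgebraicIndependent ℂ fun b => aeval (seg (X : Par → MvPolynomial Par ℂ)) (l b) := by
  obtain ⟨L, hL⟩ := exists_dual_family _ linearIndependent_tan_baseC
  refine ⟨fun b => ∑ I, C (L b I) * X I, algebraicIndependent_of_det_ne_zero _ fun h => ?_⟩
  have h1 := congrArg (eval baseC) h
  rw [RingHom.map_det, map_zero] at h1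
  have h2 : (eval baseC).mapMatrix (Matrix.of fun b a => pderiv a
      (aeval (seg (X : Par → MvPolynomial Par ℂ)) (∑ I, C (L b I) * X I))) = 1 := by
    ext b a
    simp only [RingHom.mapMatrix_apply, Matrix.map_apply, Matrix.of_apply, map_sum, map_mul,
      algHom_C, aeval_X, algebraMap_eq, pderiv_mul, pderiv_C, pderiv_seg, zero_mul, zero_add,
      eval_C, eval_tan_X, hL, Matrix.one_apply]
  rw [h2, Matrix.det_one] at h1
  exact one_ne_zero h1

/-- Points of the image of `seg` off some hypersurface have only good preimages. -/
lemma exists_forall_good : ∃ F : MvPolynomial Idx ℂ,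
    aeval (seg (X : Par → MvPolynomial Par ℂ)) F ≠ 0 ∧
      ∀ y : Par → ℂ, eval (seg y) F ≠ 0 → Good y := by
  obtain ⟨l, hl⟩ := exists_linear_algebraicIndependent
  obtain ⟨q, hq, hgood⟩ := exists_good
  obtain ⟨F, hF, r, hr⟩ := exists_dvd_aeval _ hl hq
  have h : aeval (seg (X : Par → MvPolynomial Par ℂ)) (aeval l F) =
      aeval (fun b => aeval (seg (X : Par → MvPolynomial Par ℂ)) (l b)) F :=
    comp_aeval_apply _ _ F
  refine ⟨aeval l F, h ▸ hF, fun y hy => hgood y fun h0 => hy ?_⟩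
  rw [← eval_aeval_seg, h, hr, map_mul, h0, zero_mul]

/-- A family of tensors with fewer parameters lies on a hypersurface that does not contain the
image of `seg`. -/
lemma exists_aeval_seg_ne_zero {κ : Type} [Fintype κ] (hκ : Fintype.card κ < Fintype.card Par)
    (f : Idx → MvPolynomial κ ℂ) : ∃ F : MvPolynomial Idx ℂ,
      aeval (seg (X : Par → MvPolynomial Par ℂ)) F ≠ 0 ∧ aeval f F = 0 := by
  obtain ⟨l, hl⟩ := exists_linear_algebraicIndependent
  obtain ⟨F, hF, hF0⟩ := exists_aeval_eq_zero_of_card_lt (fun b => aeval f (l b)) hκ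
  refine ⟨aeval l F, ?_, (comp_aeval_apply _ _ F).trans hF0⟩
  rw [show aeval (seg (X : Par → MvPolynomial Par ℂ)) (aeval l F) =
      aeval (fun b => aeval (seg (X : Par → MvPolynomial Par ℂ)) (l b)) F from
    comp_aeval_apply _ _ F]
  exact fun h => hF (hl (h.trans (map_zero _).symm))

/-- The coordinates of a sum of decomposable tensors. -/
def coords {ι : Type} [Fintype ι] (v : ι → Fin 6 → Fin 2 → ℂ) (I : Idx) : ℂ :=
  ∑ i, ∏ j, v i j (I j)

lemma eq_mul_chart {u : Fin 2 → ℂ} (h : u 0 + u 1 ≠ 0) (b : Fin 2) :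
    u b = (u 0 + u 1) * chart (u 1 / (u 0 + u 1)) b := by
  fin_cases b <;> simp [chart] <;> field_simp
  ring

lemma eq_mul_dir {u : Fin 2 → ℂ} (h : u 0 + u 1 = 0) (b : Fin 2) : u b = u 1 * dir b := by
  fin_cases b
  · simpa [dir] using eq_neg_of_add_eq_zero_left h
  · simp [dir]

/-- Sums of nine decomposable tensors, with the factors in `S` outside the affine chart. -/
noncomputable def boundary (S : Finset (Fin 9 × Fin 6)) (I : Idx) :
    MvPolynomial (Fin 9 ⊕ {p // p ∉ S}) ℂ :=
  ∑ i, X (Sum.inl i) * ∏ j, if h : (i, j) ∈ S then dir (I j) else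
    chart (X (Sum.inr ⟨(i, j), h⟩)) (I j)

lemma exists_eval_boundary (v : Fin 9 → Fin 6 → Fin 2 → ℂ) (S : Finset (Fin 9 × Fin 6))
    (hS : ∀ i j, (i, j) ∈ S ↔ v i j 0 + v i j 1 = 0) :
    ∃ z, ∀ I, eval z (boundary S I) = coords v I := by
  refine ⟨Sum.elim (fun i => ∏ j, if (i, j) ∈ S then v i j 1 else v i j 0 + v i j 1)
    (fun p => v p.1.1 p.1.2 1 / (v p.1.1 p.1.2 0 + v p.1.1 p.1.2 1)), fun I => ?_⟩
  simp only [boundary, coords, map_sum, map_mul, map_prod, eval_X, Sum.elim_inl,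
    ← Finset.prod_mul_distrib]
  refine Finset.sum_congr rfl fun i _ => Finset.prod_congr rfl fun j _ => ?_
  by_cases h : (i, j) ∈ S
  · rw [if_pos h, dif_pos h, map_dir]
    exact (eq_mul_dir ((hS i j).1 h) _).symm
  · rw [if_neg h, dif_neg h, map_chart, eval_X, Sum.elim_inr]
    exact (eq_mul_chart (fun h0 => h ((hS i j).2 h0)) _).symm

/-- Points of the image of `seg` off some hypersurface are not sums of nine decomposable tensors
with a factor outside the affine chart. -/
lemma exists_forall_mem_chart : ∃ F : MvPolynomial Idx ℂ,
    aeval (seg (X : Par → MvPolynomial Par ℂ)) F ≠ 0 ∧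
      ∀ v : Fin 9 → Fin 6 → Fin 2 → ℂ, eval (coords v) F ≠ 0 →
        ∀ i j, v i j 0 + v i j 1 ≠ 0 := by
  have key : ∀ S : Finset (Fin 9 × Fin 6), ∃ F : MvPolynomial Idx ℂ,
      aeval (seg (X : Par → MvPolynomial Par ℂ)) F ≠ 0 ∧
        (S.Nonempty → aeval (boundary S) F = 0) := by
    intro S
    by_cases hS : S.Nonempty
    · obtain ⟨F, h1, h2⟩ := exists_aeval_seg_ne_zero (κ := Fin 9 ⊕ {p // p ∉ S}) (by
        have hc : Fintype.card {p // p ∉ S} < Fintype.card (Fin 9 × Fin 6) := by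
          obtain ⟨p, hp⟩ := hS
          exact Fintype.card_subtype_lt (x := p) (by simpa using hp)
        rw [Fintype.card_sum, Fintype.card_sum]
        exact Nat.add_lt_add_left hc _) (boundary S)
      exact ⟨F, h1, fun _ => h2⟩
    · exact ⟨1, by simp, fun h => absurd h hS⟩
  choose F hF hF0 using key
  refine ⟨∏ S, F S, ?_, fun v hv i j hij => ?_⟩
  · rw [map_prod]
    exact Finset.prod_ne_zero_iff.2 fun S _ => hF S
  · classical
    set S := Finset.univ.filter fun p : Fin 9 × Fin 6 => v p.1 p.2 0 + v p.1 p.2 1 = 0 with hS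
    obtain ⟨z, hz⟩ := exists_eval_boundary v S (by simp [hS])
    have h1 := congrArg (eval z) (hF0 S ⟨(i, j), by simp [hS, hij]⟩)
    have h2 : eval z (aeval (boundary S) (F S)) = eval (coords v) (F S) := by
      rw [← funext hz, ← coe_aeval_eq_eval, ← coe_aeval_eq_eval]
      exact comp_aeval_apply _ (aeval z) (F S)
    rw [h2, map_zero] at h1
    rw [map_prod] at hv
    exact Finset.prod_ne_zero_iff.1 hv S (Finset.mem_univ S) h1

/-- The chart coordinates of nine decomposable tensors. -/
noncomputable def toPar (v : Fin 9 → Fin 6 → Fin 2 → ℂ) : Par → ℂ :=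
  Sum.elim (fun i => ∏ j, (v i j 0 + v i j 1)) fun p => v p.1 p.2 1 / (v p.1 p.2 0 + v p.1 p.2 1)

lemma prod_eq_toPar {v : Fin 9 → Fin 6 → Fin 2 → ℂ} (hv : ∀ i j, v i j 0 + v i j 1 ≠ 0) (i I) :
    ∏ j, v i j (I j) = toPar v (Sum.inl i) * term (toPar v) i ∅ I := by
  simp only [toPar, term, Sum.elim_inl, Sum.elim_inr, Finset.notMem_empty, if_false,
    ← Finset.prod_mul_distrib]
  exact Finset.prod_congr rfl fun j _ => eq_mul_chart (hv i j) _

lemma seg_toPar {v : Fin 9 → Fin 6 → Fin 2 → ℂ} (hv : ∀ i j, v i j 0 + v i j 1 ≠ 0) :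
    seg (toPar v) = coords v :=
  funext fun I => Finset.sum_congr rfl fun i _ => (prod_eq_toPar hv i I).symm

lemma exists_coords_eq_seg (y : Par → ℂ) :
    ∃ v : Fin 9 → Fin 6 → Fin 2 → ℂ, coords v = seg y := by
  refine ⟨fun i j b => (if j = 0 then y (Sum.inl i) else 1) * chart (y (Sum.inr (i, j))) b,
    funext fun I => Finset.sum_congr rfl fun i _ => ?_⟩
  rw [Finset.prod_mul_distrib]
  simp [term]

/-- Uniqueness of generic sums of nine decomposable tensors, in coordinates. -/
lemma exists_forall_perm : ∃ F : MvPolynomial Idx ℂ,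
    (∃ v : Fin 9 → Fin 6 → Fin 2 → ℂ, eval (coords v) F ≠ 0) ∧
      ∀ v w : Fin 9 → Fin 6 → Fin 2 → ℂ, eval (coords v) F ≠ 0 → coords w = coords v →
        ∃ σ : Equiv.Perm (Fin 9), ∀ i (I : Idx), ∏ j, w i j (I j) = ∏ j, v (σ i) j (I j) := by
  obtain ⟨F₁, hF₁, H₁⟩ := exists_forall_good
  obtain ⟨F₂, hF₂, H₂⟩ := exists_forall_mem_chart
  obtain ⟨G, hG, I₀, hI₀⟩ := exists_pderiv_ne_zero (aeval (seg (X : Par → MvPolynomial Par ℂ)))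
    (exists_aeval_eq_zero_of_card_lt (seg (X : Par → MvPolynomial Par ℂ)) (by simp))
  refine ⟨F₁ * F₂ * pderiv I₀ G, ?_, fun v w hv hw => ?_⟩
  · have h : aeval (seg (X : Par → MvPolynomial Par ℂ)) (F₁ * F₂ * pderiv I₀ G) ≠ 0 := by
      simpa only [map_mul] using mul_ne_zero (mul_ne_zero hF₁ hF₂) hI₀
    obtain ⟨y, hy⟩ : ∃ y, eval y (aeval (seg (X : Par → MvPolynomial Par ℂ))
        (F₁ * F₂ * pderiv I₀ G)) ≠ 0 := by
      by_contra! h0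
      exact h (funext fun y => by rw [h0, map_zero])
    obtain ⟨v, hv⟩ := exists_coords_eq_seg y
    exact ⟨v, by rwa [hv, ← eval_aeval_seg]⟩
  · rw [map_mul, map_mul] at hv
    have hv' := H₂ v (right_ne_zero_of_mul (left_ne_zero_of_mul hv))
    have hw' := H₂ w (hw ▸ right_ne_zero_of_mul (left_ne_zero_of_mul hv))
    have hgv := H₁ (toPar v) (by
      rw [seg_toPar hv']; exact left_ne_zero_of_mul (left_ne_zero_of_mul hv))
    have hgw := H₁ (toPar w) (by
      rw [seg_toPar hw', hw]; exact left_ne_zero_of_mul (left_ne_zero_of_mul hv))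
    obtain ⟨σ, hσ⟩ := exists_perm_of_seg_eq hG hgv hgw (by rw [seg_toPar hv', seg_toPar hw', hw])
      (fun h0 => right_ne_zero_of_mul hv (by
        rw [← seg_toPar hv']; exact congrFun h0 I₀))
    refine ⟨σ, fun i I => ?_⟩
    rw [prod_eq_toPar hw', prod_eq_toPar hv', (hσ i).1, (hσ i).2]

end Elimination

section Tensors

lemma repr_tprod (v : Fin 6 → Fin 2 → ℂ) (I : Idx) :
    (Basis.piTensorProduct fun _ : Fin 6 => Pi.basisFun ℂ (Fin 2)).repr (⨂ₜ[ℂ] j, v j) I =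
      ∏ j, v j (I j) := by
  simp [Basis.piTensorProduct_repr_tprod_apply]

lemma repr_sum_tprod {ι : Type} [Fintype ι] (v : ι → Fin 6 → Fin 2 → ℂ) (I : Idx) :
    (Basis.piTensorProduct fun _ : Fin 6 => Pi.basisFun ℂ (Fin 2)).repr
      (∑ i, ⨂ₜ[ℂ] j, v i j) I = coords v I := by
  simp only [map_sum, Finsupp.coe_finsetSum, Finset.sum_apply, repr_tprod, coords]

lemma tprod_eq_of_prod_eq {v w : Fin 6 → Fin 2 → ℂ}
    (h : ∀ I : Idx, ∏ j, v j (I j) = ∏ j, w j (I j)) :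
    (⨂ₜ[ℂ] j, v j) = ⨂ₜ[ℂ] j, w j :=
  (Basis.piTensorProduct fun _ : Fin 6 => Pi.basisFun ℂ (Fin 2)).repr.injective <|
    Finsupp.ext fun I => by rw [repr_tprod, repr_tprod, h]

lemma exists_eq_sum_singleton {α : Type*} (n : ℕ) (D : Multiset α) (hD : Multiset.card D = n) :
    ∃ f : Fin n → α, D = ∑ i, {f i} := by
  induction n generalizing D with
  | zero => exact ⟨Fin.elim0, by simpa using hD⟩
  | succ n ih =>
    obtain ⟨a, D', rfl, hD'⟩ := Multiset.card_eq_succ_iff.1 hD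
    obtain ⟨f, hf⟩ := ih D' hD'
    exact ⟨Fin.cons a f, by simp [Fin.sum_univ_succ, ← hf]⟩

lemma sum_singleton_eq_map {ι α : Type*} [Fintype ι] (f : ι → α) :
    ∑ i, ({f i} : Multiset α) = Multiset.map f Finset.univ.val := by
  rw [← Multiset.sum_map_singleton (Multiset.map f _), Multiset.map_map]
  rfl

lemma coords_sumElim {ι κ : Type} [Fintype ι] [Fintype κ] (v : ι → Fin 6 → Fin 2 → ℂ)
    (u : κ → Fin 6 → Fin 2 → ℂ) (e : Fin 9 ≃ ι ⊕ κ) :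
    coords (fun i => Sum.elim v u (e i)) = coords v + coords u := by
  ext I
  rw [Pi.add_apply]
  simp only [coords]
  rw [Equiv.sum_comp e fun i => ∏ j, Sum.elim v u i j (I j), Fintype.sum_sum_type]
  rfl

end Tensors

theorem segre_P1_pow6_identifiable (k : ℕ) (hk1 : 1 ≤ k) (hk8 : k ≤ 8) :
    ∃ P : MvPolynomial (Fin (k + 1) × Fin 6 × Fin 2) ℂ, P ≠ 0 ∧
      ∀ v : Fin (k + 1) → Fin 6 → Fin 2 → ℂ,
        MvPolynomial.eval (fun p => v p.1 p.2.1 p.2.2) P ≠ 0 →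
        ∀ D : Multiset (BinTensor 6),
          IsDecomposition (k + 1) (∑ i : Fin (k + 1), ⨂ₜ[ℂ] j, v i j) D →
          D = Multiset.map (fun i : Fin (k + 1) => ⨂ₜ[ℂ] j, v i j) Finset.univ.val := by
  obtain ⟨F, ⟨v₀, hv₀⟩, hF⟩ := exists_forall_perm
  let e : Fin 9 ≃ Fin (k + 1) ⊕ Fin (8 - k) :=
    ((finSumFinEquiv).trans (finCongr (by omega))).symm
  let u : Fin (8 - k) → Fin 6 → Fin 2 → ℂ := fun i => v₀ (e.symm (Sum.inr i))
  let P : MvPolynomial (Fin (k + 1) × Fin 6 × Fin 2) ℂ :=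
    MvPolynomial.aeval (fun I : Idx => (∑ i : Fin (k + 1), ∏ j, MvPolynomial.X (i, j, I j)) +
      MvPolynomial.C (coords u I)) F
  have hP : ∀ v : Fin (k + 1) → Fin 6 → Fin 2 → ℂ,
      MvPolynomial.eval (fun p => v p.1 p.2.1 p.2.2) P =
        MvPolynomial.eval (coords fun i => Sum.elim v u (e i)) F := by
    intro v
    rw [coords_sumElim, ← MvPolynomial.coe_aeval_eq_eval, ← MvPolynomial.coe_aeval_eq_eval]
    refine (MvPolynomial.comp_aeval_apply _
      (MvPolynomial.aeval fun p : Fin (k + 1) × Fin 6 × Fin 2 => v p.1 p.2.1 p.2.2) F).trans ?_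
    refine congrArg (fun g => MvPolynomial.aeval g F) (funext fun I => ?_)
    simp [coords]
  refine ⟨P, fun h0 => hv₀ ?_, fun v hv D hD => ?_⟩
  · have h := hP fun i => v₀ (e.symm (Sum.inl i))
    have h1 : (fun i => Sum.elim (fun i => v₀ (e.symm (Sum.inl i))) u (e i)) = v₀ := by
      funext i
      obtain ⟨s, rfl⟩ := e.symm.surjective i
      rw [e.apply_symm_apply]
      cases s <;> rfl
    rwa [h0, map_zero, h1, eq_comm] at h
  · obtain ⟨hcard, hdec, hsum⟩ := hD
    obtain ⟨f, rfl⟩ := exists_eq_sum_singleton _ D hcard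
    have hf : ∀ i, ∃ w : Fin 6 → Fin 2 → ℂ, f i = ⨂ₜ[ℂ] j, w j := fun i =>
      (hdec (f i) (Multiset.mem_sum.2 ⟨i, Finset.mem_univ i, Multiset.mem_singleton_self _⟩)).2
    choose w hw using hf
    obtain rfl : f = fun i => ⨂ₜ[ℂ] j, w i j := funext hw
    rw [Multiset.sum_sum] at hsum
    simp only [Multiset.sum_singleton] at hsum
    have hwv : coords w = coords v := funext fun I => by
      rw [← repr_sum_tprod, hsum, repr_sum_tprod]
    obtain ⟨σ, hσ⟩ := hF (fun i => Sum.elim v u (e i)) (fun i => Sum.elim w u (e i))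
      (by rwa [← hP]) (by rw [coords_sumElim, coords_sumElim, hwv])
    have h1 : ∑ s, ({⨂ₜ[ℂ] j, Sum.elim w u s j} : Multiset (BinTensor 6)) =
        ∑ s, {⨂ₜ[ℂ] j, Sum.elim v u s j} := by
      rw [← Equiv.sum_comp e, ← Equiv.sum_comp e,
        ← Equiv.sum_comp σ fun i => ({⨂ₜ[ℂ] j, Sum.elim v u (e i) j} : Multiset (BinTensor 6))]
      exact Finset.sum_congr rfl fun i _ => by rw [tprod_eq_of_prod_eq (hσ i)]
    rw [Fintype.sum_sum_type, Fintype.sum_sum_type] at h1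
    refine (add_right_cancel h1).trans ?_
    exact sum_singleton_eq_map _
end

section
/- Let K be a field and V, W finite-dimensional K-vector spaces with dim W ≥ 2. Let H_0, …, H_k be subspaces of V whose sum H_0 + ⋯ + H_k is not direct (equivalently, dim H_0 + ⋯ + dim H_k > dim(H_0 + ⋯ + H_k)), and let d = dim(H_0 + ⋯ + H_k). Then there exist vectors w_0, …, w_k ∈ W such that the subspace of V ⊗ W spanned by the union of the images of the maps h ↦ h ⊗ w_i restricted to H_i (i = 0,…,k) has dimension at least d + 1. -/
open scoped TensorProduct

theorem iSupIndep.finrank_iSup {K V ι : Type*} [Field K] [AddCommGroup V] [Module K V]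
    [FiniteDimensional K V] [Fintype ι] {H : ι → Submodule K V} (hH : iSupIndep H) :
    Module.finrank K ↥(⨆ i, H i) = ∑ i, Module.finrank K ↥(H i) := by
  classical
  rw [Submodule.iSup_eq_range_dfinsupp_lsum,
    LinearMap.finrank_range_of_inj hH.dfinsupp_lsum_injective]
  exact Module.finrank_directSum K fun i => ↥(H i)

/-- A family with `∑ dim H i > dim (⨆ H i)` has a member meeting the span of the others. -/
theorem exists_finrank_iSup_lt_add {K V ι : Type*} [Field K] [AddCommGroup V] [Module K V]
    [FiniteDimensional K V] [Fintype ι] {H : ι → Submodule K V}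
    (hH : Module.finrank K ↥(⨆ i, H i) < ∑ i, Module.finrank K ↥(H i)) :
    ∃ j, Module.finrank K ↥(⨆ i, H i) <
      Module.finrank K ↥(H j) + Module.finrank K ↥(⨆ (i) (_ : i ≠ j), H i) := by
  by_contra! h
  refine hH.ne (iSupIndep.finrank_iSup fun j => ?_)
  have hdim := Submodule.finrank_sup_add_finrank_inf_eq (H j) (⨆ (i) (_ : i ≠ j), H i)
  rw [← iSup_split_single] at hdim
  have hj := h j
  rw [disjoint_iff, ← Submodule.finrank_eq_zero (R := K)]
  omega

theorem rid_lTensor_mk_flip {K V W : Type*} [Field K] [AddCommGroup V] [Module K V]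
    [AddCommGroup W] [Module K W] (f : W →ₗ[K] K) (w : W) (x : V) :
    TensorProduct.rid K V (f.lTensor V ((TensorProduct.mk K V W).flip w x)) = f w • x := by
  simp

theorem finrank_map_mk_flip {K V W : Type*} [Field K] [AddCommGroup V] [Module K V]
    [AddCommGroup W] [Module K W] {f : W →ₗ[K] K} {w : W} (hf : f w = 1) (A : Submodule K V) :
    Module.finrank K ↥(A.map ((TensorProduct.mk K V W).flip w)) = Module.finrank K ↥A := by
  refine (Submodule.equivMapOfInjective _ (fun x y hxy => ?_) A).finrank_eq.symm
  have := congrArg (fun t => TensorProduct.rid K V (f.lTensor V t)) hxy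
  simpa only [rid_lTensor_mk_flip, hf, one_smul] using this

theorem disjoint_map_mk_flip {K V W : Type*} [Field K] [AddCommGroup V] [Module K V]
    [AddCommGroup W] [Module K W] {f : W →ₗ[K] K} {u v : W} (hu : f u = 1) (hv : f v = 0)
    (A B : Submodule K V) :
    Disjoint (A.map ((TensorProduct.mk K V W).flip u))
      (B.map ((TensorProduct.mk K V W).flip v)) := by
  rw [Submodule.disjoint_def]
  rintro _ ⟨a, -, rfl⟩ ⟨b, -, hb⟩
  have := congrArg (fun t => TensorProduct.rid K V (f.lTensor V t)) hb
  simp only [rid_lTensor_mk_flip, hu, hv, one_smul, zero_smul] at this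
  rw [← this, map_zero]

theorem span_of_tensored_subspaces_jumps
    (K : Type*) [Field K] (V W : Type*) [AddCommGroup V] [Module K V]
    [AddCommGroup W] [Module K W] [FiniteDimensional K V] [FiniteDimensional K W]
    (hW : 2 ≤ Module.finrank K W)
    (k : ℕ) (H : Fin (k + 1) → Submodule K V)
    (hnotdirect :
      Module.finrank K (↥(⨆ i, H i)) < ∑ i, Module.finrank K (↥(H i))) :
    ∃ w : Fin (k + 1) → W,
      Module.finrank K (↥(⨆ i, (H i).map ((TensorProduct.mk K V W).flip (w i)))) ≥
        Module.finrank K (↥(⨆ i, H i)) + 1 := by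
  obtain ⟨j, hj⟩ := exists_finrank_iSup_lt_add hnotdirect
  let b := Module.finBasis K W
  let p : Fin (Module.finrank K W) := ⟨0, by omega⟩
  let q : Fin (Module.finrank K W) := ⟨1, by omega⟩
  have hpp : b.coord p (b p) = 1 := by simp
  have hqq : b.coord q (b q) = 1 := by simp
  have hpq : b.coord p (b q) = 0 := by simp [p, q]
  refine ⟨fun i => if i = j then b p else b q, ?_⟩
  have hsplit : (⨆ i, (H i).map ((TensorProduct.mk K V W).flip (if i = j then b p else b q))) =
      (H j).map ((TensorProduct.mk K V W).flip (b p)) ⊔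
        (⨆ (i) (_ : i ≠ j), H i).map ((TensorProduct.mk K V W).flip (b q)) := by
    rw [iSup_split_single _ j, if_pos rfl]
    simp only [Submodule.map_iSup]
    congr 1
    refine iSup_congr fun i => iSup_congr fun hi => ?_
    rw [if_neg hi]
  have hdim := Submodule.finrank_sup_add_finrank_inf_eq
    ((H j).map ((TensorProduct.mk K V W).flip (b p)))
    ((⨆ (i) (_ : i ≠ j), H i).map ((TensorProduct.mk K V W).flip (b q)))
  rw [(disjoint_map_mk_flip hpp hpq _ _).eq_bot, finrank_bot, add_zero,
    finrank_map_mk_flip hpp, finrank_map_mk_flip hqq] at hdim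
  rw [hsplit, hdim]
  exact hj
end

section
/- Let m ≥ 2 and k ≥ 1 be integers with (k+1)·(m+1) > 2^m. Then the Segre product of m copies of ℙ¹ is not k-identifiable; in fact, concretely: there exists a nonzero polynomial P on the parameter space ((ℂ²)^m)^{k+1} such that for every parameter v = (v_{i,j}) with P(v) ≠ 0, the tensor T(v) = Σ_{i=0}^{k} v_{i,0} ⊗ ⋯ ⊗ v_{i,m−1} ∈ ⨂^m ℂ² admits at least two distinct decompositions of length k+1 (two distinct multisets of k+1 nonzero decomposable tensors summing to T(v)). -/
open scoped TensorProduct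

/-- Chain rule for a polynomial evaluated along a curve. -/
theorem hasDerivAt_eval_mvPolynomial {σ : Type*} [Fintype σ] (Q : MvPolynomial σ ℂ)
    {γ : ℝ → σ → ℂ} {γ' : σ → ℂ} {s : ℝ} (hγ : HasDerivAt γ γ' s) :
    HasDerivAt (fun s => MvPolynomial.eval (γ s) Q)
      (∑ i, MvPolynomial.eval (γ s) (MvPolynomial.pderiv i Q) * γ' i) s := by
  classical
  induction Q using MvPolynomial.induction_on with
  | C a => simpa using hasDerivAt_const s a
  | add p q hp hq =>
    simp only [map_add, add_mul, Finset.sum_add_distrib]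
    exact hp.add hq
  | mul_X p j hp =>
    simp only [map_mul, MvPolynomial.eval_X]
    refine (hp.mul (hasDerivAt_pi.1 hγ j)).congr_deriv ?_
    simp [Derivation.leibniz, add_mul, Finset.sum_add_distrib, MvPolynomial.pderiv_X,
      Pi.single_apply, Finset.sum_mul, apply_ite, ite_mul]
    rw [add_comm]
    congr 1
    exact Finset.sum_congr rfl fun i _ => by ring

/-- Fewer polynomials than variables admit a nonzero polynomial vector field annihilating all of
them. -/
theorem exists_ne_zero_sum_pderiv_mul_eq_zero {K σ τ : Type*} [Field K] [Fintype σ] [Fintype τ]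
    (Q : τ → MvPolynomial σ K) (hcard : Fintype.card τ < Fintype.card σ) :
    ∃ X : σ → MvPolynomial σ K, X ≠ 0 ∧
      ∀ t, ∑ i, MvPolynomial.pderiv i (Q t) * X i = 0 := by
  by_contra! h
  refine hcard.not_ge (card_le_of_injective (MvPolynomial σ K)
    (Matrix.mulVecLin (Matrix.of fun t i => MvPolynomial.pderiv i (Q t))) ?_)
  rw [injective_iff_map_eq_zero]
  intro X hX
  by_contra hne
  obtain ⟨t, ht⟩ := h X hne
  exact ht (congrFun hX t)

open Filter Topology in
/-- The generic fibre of a polynomial map to a space of smaller dimension contains nonconstant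
curves. -/
theorem exists_curve_in_generic_fiber {σ τ : Type*} [Fintype σ] [Fintype τ]
    (Q : τ → MvPolynomial σ ℂ) (hcard : Fintype.card τ < Fintype.card σ) :
    ∃ P : MvPolynomial σ ℂ, P ≠ 0 ∧ ∀ v : σ → ℂ, MvPolynomial.eval v P ≠ 0 →
      ∃ γ : ℝ → σ → ℂ, γ 0 = v ∧ ContinuousAt γ 0 ∧
        (∀ᶠ s in 𝓝 0, ∀ t, MvPolynomial.eval (γ s) (Q t) = MvPolynomial.eval v (Q t)) ∧
        ¬ ∀ᶠ s in 𝓝 0, γ s = v := by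
  obtain ⟨X, hX, hQX⟩ := exists_ne_zero_sum_pderiv_mul_eq_zero Q hcard
  obtain ⟨i, hi⟩ := Function.ne_iff.1 hX
  refine ⟨X i, hi, fun v hv => ?_⟩
  have hsmooth : ContDiffAt ℝ 1 (fun x : σ → ℂ => fun i => MvPolynomial.eval x (X i)) v :=
    contDiffAt_pi.2 fun i =>
      ((AnalyticOnNhd.eval_mvPolynomial (X i) v (Set.mem_univ v)).contDiffAt).restrict_scalars ℝ
  obtain ⟨γ, hγ0, ε, hε, hγ⟩ :=
    hsmooth.exists_forall_mem_closedBall_exists_eq_forall_mem_Ioo_hasDerivAt₀ 0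
  have h0 : (0 : ℝ) ∈ Set.Ioo (0 - ε) (0 + ε) := by constructor <;> linarith
  refine ⟨γ, hγ0, (hγ 0 h0).continuousAt, ?_, fun hconst => hv ?_⟩
  · filter_upwards [isOpen_Ioo.mem_nhds h0] with s hs t
    have hderiv : ∀ r ∈ Set.Ioo (0 - ε) (0 + ε),
        HasDerivAt (fun s => MvPolynomial.eval (γ s) (Q t)) 0 r := fun r hr => by
      refine (hasDerivAt_eval_mvPolynomial (Q t) (hγ r hr)).congr_deriv ?_
      simpa using congrArg (MvPolynomial.eval (γ r)) (hQX t)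
    rw [← hγ0]
    exact isOpen_Ioo.is_const_of_deriv_eq_zero isPreconnected_Ioo
      (fun r hr => (hderiv r hr).differentiableAt.differentiableWithinAt)
      (fun r hr => (hderiv r hr).deriv) hs h0
  · have hzero := (hγ 0 h0).unique ((hasDerivAt_const (0 : ℝ) v).congr_of_eventuallyEq hconst)
    simpa [hγ0] using congrFun hzero i

/-- The coordinates of a tensor in the standard basis of `⨂^m ℂ²`. -/
noncomputable def tensorCoord (m : ℕ) : BinTensor m ≃ₗ[ℂ] ((Fin m → Fin 2) →₀ ℂ) :=
  (Basis.piTensorProduct fun _ : Fin m => Pi.basisFun ℂ (Fin 2)).repr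

theorem tensorCoord_tprod {m : ℕ} (w : Fin m → Fin 2 → ℂ) (f : Fin m → Fin 2) :
    tensorCoord m (⨂ₜ[ℂ] j, w j) f = ∏ j, w j (f j) := by
  simp [tensorCoord, Basis.piTensorProduct_repr_tprod_apply]

theorem tprod_ne_zero_of_forall_ne_zero {m : ℕ} {w : Fin m → Fin 2 → ℂ}
    (hw : ∀ j, w j 0 ≠ 0) : (⨂ₜ[ℂ] j, w j) ≠ 0 := by
  intro h
  have := tensorCoord_tprod w fun _ => 0
  rw [h, map_zero, Finsupp.zero_apply] at this
  exact Finset.prod_ne_zero_iff.2 (fun j _ => hw j) this.symm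

/-- A pure tensor with nonzero entries determines its factors once the scaling of all but the
first factor is fixed. -/
theorem eq_of_tprod_eq_tprod {n : ℕ} {a b : Fin (n + 1) → Fin 2 → ℂ} (hb : ∀ j, b j 0 ≠ 0)
    (hscale : ∀ j : Fin n, a j.succ 0 = b j.succ 0)
    (h : (⨂ₜ[ℂ] j, a j) = ⨂ₜ[ℂ] j, b j) : a = b := by
  have hcoord : ∀ f : Fin (n + 1) → Fin 2, ∏ j, a j (f j) = ∏ j, b j (f j) := fun f => by
    rw [← tensorCoord_tprod, ← tensorCoord_tprod, h]
  have hzero : ∀ j, a j 0 = b j 0 := by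
    refine Fin.cases ?_ hscale
    have h0 := hcoord fun _ => 0
    simp only [Fin.prod_univ_succ, hscale] at h0
    exact mul_right_cancel₀ (Finset.prod_ne_zero_iff.2 fun j _ => hb j.succ) h0
  have hone : ∀ j, a j 1 = b j 1 := fun j => by
    have hj := hcoord (Function.update (fun _ => 0) j 1)
    rw [← Finset.mul_prod_erase _ _ (Finset.mem_univ j),
      ← Finset.mul_prod_erase _ _ (Finset.mem_univ j)] at hj
    have hrest : ∀ c : Fin (n + 1) → Fin 2 → ℂ,
        ∏ l ∈ Finset.univ.erase j, c l (Function.update (fun _ => (0 : Fin 2)) j 1 l) =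
          ∏ l ∈ Finset.univ.erase j, c l 0 := fun c =>
      Finset.prod_congr rfl fun l hl => by
        rw [Function.update_of_ne (Finset.ne_of_mem_erase hl)]
    rw [hrest, hrest, Function.update_self, Finset.prod_congr rfl fun l _ => hzero l] at hj
    exact mul_right_cancel₀ (Finset.prod_ne_zero_iff.2 fun l _ => hb l) hj
  funext j e
  fin_cases e
  exacts [hzero j, hone j]

/-- The multiset of rank-one summands attached to a parameter. -/
noncomputable def summands {k m : ℕ} (v : Fin k → Fin m → Fin 2 → ℂ) : Multiset (BinTensor m) :=
  Finset.univ.val.map fun i => ⨂ₜ[ℂ] j, v i j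

theorem isDecomposition_summands {k m : ℕ} {v : Fin k → Fin m → Fin 2 → ℂ}
    (hv : ∀ i j, v i j 0 ≠ 0) :
    IsDecomposition k (∑ i, ⨂ₜ[ℂ] j, v i j) (summands v) := by
  refine ⟨by simp [summands], fun t ht => ?_, rfl⟩
  obtain ⟨i, -, rfl⟩ := Multiset.mem_map.1 ht
  exact ⟨tprod_ne_zero_of_forall_ne_zero (hv i), v i, rfl⟩

open Filter Topology in
/-- If the summands along a continuous family form a fixed multiset, then each summand is locally
constant. -/
theorem eventually_tprod_eq_of_summands_eq {k m : ℕ} {γ : ℝ → Fin k → Fin m → Fin 2 → ℂ}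
    (hγ : ContinuousAt γ 0) (h : ∀ᶠ s in 𝓝 0, summands (γ s) = summands (γ 0)) :
    ∀ᶠ s in 𝓝 0, ∀ i, (⨂ₜ[ℂ] j, γ s i j) = ⨂ₜ[ℂ] j, γ 0 i j := by
  rw [eventually_all]
  intro i
  let c : ℝ → (Fin m → Fin 2) → ℂ := fun s f => ∏ j, γ s i j (f j)
  have hc : ContinuousAt c 0 := by
    refine continuousAt_pi.2 fun f => tendsto_finsetProd _ fun j _ => ?_
    exact continuousAt_pi.1 (continuousAt_pi.1 (continuousAt_pi.1 hγ i) j) (f j)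
  let S : Set ((Fin m → Fin 2) → ℂ) := Set.range fun l f => ∏ j, γ 0 l j (f j)
  have hS : (S \ {c 0})ᶜ ∈ 𝓝 (c 0) :=
    ((Set.finite_range _).subset Set.sdiff_subset).isClosed.isOpen_compl.mem_nhds (by simp)
  filter_upwards [h, hc hS] with s hs hcs
  have hmem : (⨂ₜ[ℂ] j, γ s i j) ∈ summands (γ 0) :=
    hs ▸ Multiset.mem_map_of_mem _ (Finset.mem_univ i)
  obtain ⟨l, -, hl⟩ := Multiset.mem_map.1 hmem
  have hcS : c s ∈ S := ⟨l, funext fun f => by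
    simp only [c, ← tensorCoord_tprod, hl]⟩
  have hcc : c s = c 0 := by
    by_contra hne
    exact hcs ⟨hcS, hne⟩
  refine (tensorCoord m).injective (Finsupp.ext fun f => ?_)
  rw [tensorCoord_tprod, tensorCoord_tprod]
  exact congrFun hcc f

theorem segre_not_identifiable_above_dimension_bound
    (m k : ℕ) (hm : 2 ≤ m) (hk : 1 ≤ k) (hkm : 2 ^ m < (k + 1) * (m + 1)) :
    ∃ P : MvPolynomial (Fin (k + 1) × Fin m × Fin 2) ℂ, P ≠ 0 ∧
      ∀ v : Fin (k + 1) → Fin m → Fin 2 → ℂ,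
        MvPolynomial.eval (fun p => v p.1 p.2.1 p.2.2) P ≠ 0 →
        ∃ D₁ D₂ : Multiset (BinTensor m), D₁ ≠ D₂ ∧
          IsDecomposition (k + 1) (∑ i : Fin (k + 1), ⨂ₜ[ℂ] j, v i j) D₁ ∧
          IsDecomposition (k + 1) (∑ i : Fin (k + 1), ⨂ₜ[ℂ] j, v i j) D₂ := by
  obtain ⟨n, rfl⟩ : ∃ n, m = n + 1 := ⟨m - 1, by omega⟩
  let Q : (Fin (n + 1) → Fin 2) ⊕ (Fin (k + 1) × Fin n) →
      MvPolynomial (Fin (k + 1) × Fin (n + 1) × Fin 2) ℂ :=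
    Sum.elim (fun f => ∑ i, ∏ j, MvPolynomial.X (i, j, f j))
      (fun p => MvPolynomial.X (p.1, p.2.succ, 0))
  have hcard : Fintype.card ((Fin (n + 1) → Fin 2) ⊕ (Fin (k + 1) × Fin n)) <
      Fintype.card (Fin (k + 1) × Fin (n + 1) × Fin 2) := by
    simp only [Fintype.card_sum, Fintype.card_prod, Fintype.card_fun, Fintype.card_fin]
    nlinarith
  obtain ⟨P, hP, hcurve⟩ := exists_curve_in_generic_fiber Q hcard
  refine ⟨P * ∏ p, MvPolynomial.X p,
    mul_ne_zero hP (Finset.prod_ne_zero_iff.2 fun p _ => MvPolynomial.X_ne_zero p),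
    fun v hv => ?_⟩
  simp only [map_mul, map_prod, MvPolynomial.eval_X] at hv
  obtain ⟨hvP, hvX⟩ := mul_ne_zero_iff.1 hv
  have hv0 : ∀ i j, v i j 0 ≠ 0 := fun i j =>
    Finset.prod_ne_zero_iff.1 hvX (i, j, 0) (Finset.mem_univ _)
  obtain ⟨γ, hγ0, hγc, hγQ, hγne⟩ := hcurve _ hvP
  let δ : ℝ → Fin (k + 1) → Fin (n + 1) → Fin 2 → ℂ := fun s i j e => γ s (i, j, e)
  have hδ0 : δ 0 = v := by
    funext i j e
    exact congrFun hγ0 (i, j, e)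
  have hδc : ContinuousAt δ 0 :=
    continuousAt_pi.2 fun i => continuousAt_pi.2 fun j => continuousAt_pi.2 fun e =>
      continuousAt_pi.1 hγc (i, j, e)
  have hδne : ∀ᶠ s in nhds 0, ∀ i j, δ s i j 0 ≠ 0 := by
    simp only [Filter.eventually_all]
    intro i j
    refine (continuousAt_pi.1 (continuousAt_pi.1 (continuousAt_pi.1 hδc i) j) 0).eventually_ne ?_
    rw [hδ0]
    exact hv0 i j
  have hmoves : ∃ᶠ s in nhds 0, summands (δ s) ≠ summands v := by
    intro hall
    refine hγne ?_
    have hall' : ∀ᶠ s in nhds 0, summands (δ s) = summands (δ 0) := by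
      simpa [hδ0] using hall
    filter_upwards [eventually_tprod_eq_of_summands_eq hδc hall', hγQ] with s hs hQ
    funext ⟨i, j, e⟩
    have hi : δ s i = v i := by
      refine eq_of_tprod_eq_tprod (hv0 i) (fun l => ?_) ((hs i).trans (by rw [hδ0]))
      simpa [Q] using hQ (Sum.inr (i, l))
    exact congrFun (congrFun hi j) e
  obtain ⟨s, hs, hne, hQ⟩ := (hmoves.and_eventually (hδne.and hγQ)).exists
  have hsum : ∑ i, (⨂ₜ[ℂ] j, δ s i j) = ∑ i, ⨂ₜ[ℂ] j, v i j := by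
    refine (tensorCoord (n + 1)).injective (Finsupp.ext fun f => ?_)
    simp only [map_sum, Finsupp.finsetSum_apply, tensorCoord_tprod]
    simpa [Q] using hQ (Sum.inl f)
  exact ⟨summands v, summands (δ s), hs.symm, isDecomposition_summands hv0,
    hsum ▸ isDecomposition_summands hne⟩
end
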